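/- arXiv:2201.01136 — 4 statements merged into one kernel-verified Lean document; each statement's English description precedes it below -/
import Mathlib

section
/- Every functor F : C ⥤ D between categories factors as F = s ⋙ p, where p : E ⥤ D is a discrete fibration (for every object X of E and every morphism u : d ⟶ p.obj X in D there is a unique morphism h in E with codomain X such that p.map h = u) and s : C ⥤ E is a final (cofinal) functor. -/
open CategoryTheory Opposite

universe v₁ v₂ u₁ u₂

/-- A functor `p : E ⥤ C` is a *discrete fibration* if for every object `X` of `E` and every
morphism `u : c ⟶ p.obj X` in `C` there is a unique morphism `h : X' ⟶ X` of `E` lying over `u`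
(i.e. `p.obj X' = c` and `p.map h` equals `u` modulo this identification). -/
def IsDiscreteFibration {E : Type*} {C : Type*} [Category E] [Category C] (p : E ⥤ C) : Prop :=
  ∀ ⦃X : E⦄ ⦃c : C⦄ (u : c ⟶ p.obj X),
    ∃! fh : (X' : E) × (X' ⟶ X), ∃ e : p.obj fh.1 = c, p.map fh.2 = eqToHom e ≫ u

namespace CategoryTheory.Functor

variable {C : Type u₁} {D : Type u₂} [Category.{v₁} C] [Category.{v₂} D]

/-- The category of elements of the presheaf on `D` sending `d` to the set of connected components
of the category of arrows `d ⟶ F.obj c`. -/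
structure ComponentElements (F : C ⥤ D) where
  /-- The underlying object of `D`. -/
  base : D
  /-- A connected component of the category of arrows out of `base`. -/
  fiber : ConnectedComponents (StructuredArrow base F)

namespace ComponentElements

variable {F : C ⥤ D}

lemma map_id_fiber {d : D} (x : ConnectedComponents (StructuredArrow d F)) :
    (StructuredArrow.map (𝟙 d)).mapConnectedComponents x = x := by
  induction x using Quotient.inductionOn with | _ a
  simp only [mapConnectedComponents_mk, StructuredArrow.map_id]
  rfl

lemma map_comp_fiber {d d' d'' : D} (u : d ⟶ d') (v : d' ⟶ d'')
    (x : ConnectedComponents (StructuredArrow d'' F)) :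
    (StructuredArrow.map (u ≫ v)).mapConnectedComponents x =
      (StructuredArrow.map u).mapConnectedComponents
        ((StructuredArrow.map v).mapConnectedComponents x) := by
  induction x using Quotient.inductionOn with | _ a
  simp only [mapConnectedComponents_mk, StructuredArrow.map_comp]
  rfl

instance : Category.{v₂} (ComponentElements F) where
  Hom X Y := { u : X.base ⟶ Y.base //
    (StructuredArrow.map u).mapConnectedComponents Y.fiber = X.fiber }
  id X := ⟨𝟙 X.base, map_id_fiber X.fiber⟩
  comp u v := ⟨u.1 ≫ v.1, by rw [map_comp_fiber, v.2, u.2]⟩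
  id_comp _ := Subtype.ext (Category.id_comp _)
  comp_id _ := Subtype.ext (Category.comp_id _)
  assoc _ _ _ := Subtype.ext (Category.assoc _ _ _)

variable (F) in
/-- The projection from the category of elements to `D`. -/
def proj : ComponentElements F ⥤ D where
  obj X := X.base
  map u := u.1

lemma isDiscreteFibration_proj : IsDiscreteFibration (proj F) := by
  intro X c u
  refine ⟨⟨⟨c, (StructuredArrow.map u).mapConnectedComponents X.fiber⟩, ⟨u, rfl⟩⟩,
    ⟨rfl, (Category.id_comp u).symm⟩, ?_⟩
  rintro ⟨⟨c', x⟩, ⟨v, hv⟩⟩ ⟨e, h⟩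
  change c' = c at e
  subst e
  obtain rfl : u = v := (h.trans (Category.id_comp u)).symm
  change (StructuredArrow.map (S := c') u).mapConnectedComponents X.fiber = x at hv
  subst hv
  rfl

lemma mapConnectedComponents_mk_id {d : D} {c : C} (u : d ⟶ F.obj c) :
    (StructuredArrow.map u).mapConnectedComponents
      (ConnectedComponents.mk (StructuredArrow.mk (𝟙 (F.obj c)))) =
      ConnectedComponents.mk (StructuredArrow.mk u) :=
  congrArg ConnectedComponents.mk
    ((StructuredArrow.map_mk ..).trans (congrArg StructuredArrow.mk (Category.comp_id u)))

variable (F) in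
/-- The functor sending `c` to the component of the identity of `F.obj c`. -/
def unit : C ⥤ ComponentElements F where
  obj c := ⟨F.obj c, ConnectedComponents.mk (StructuredArrow.mk (𝟙 (F.obj c)))⟩
  map f := ⟨F.map f, (mapConnectedComponents_mk_id (F.map f)).trans
    (Quotient.sound' (Zigzag.of_inv (StructuredArrow.homMk f (Category.id_comp (F.map f)))))⟩
  map_id c := Subtype.ext (F.map_id c)
  map_comp f g := Subtype.ext (F.map_comp f g)

/-- A connected component of the arrows out of `X.base` maps to the arrows out of `X`. -/
def componentToStructuredArrow (X : ComponentElements F) :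
    X.fiber.Component ⥤ StructuredArrow X (unit F) where
  obj a := StructuredArrow.mk (Y := a.obj.right)
    (⟨a.obj.hom, (mapConnectedComponents_mk_id a.obj.hom).trans a.property⟩ :
      X ⟶ (unit F).obj a.obj.right)
  map f := StructuredArrow.homMk f.hom.right (Subtype.ext (StructuredArrow.w f.hom))

lemma componentToStructuredArrow_obj_surjective (X : ComponentElements F) :
    Function.Surjective (componentToStructuredArrow X).obj := by
  intro a
  exact ⟨⟨StructuredArrow.mk a.hom.1,
    (mapConnectedComponents_mk_id a.hom.1).symm.trans a.hom.2⟩, (StructuredArrow.eq_mk a).symm⟩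

instance : (unit F).Final where
  out X := by
    have hs := componentToStructuredArrow_obj_surjective X
    have : Nonempty (StructuredArrow X (unit F)) :=
      Nonempty.map (componentToStructuredArrow X).obj inferInstance
    refine zigzag_isConnected fun a b ↦ ?_
    obtain ⟨a, rfl⟩ := hs a
    obtain ⟨b, rfl⟩ := hs b
    exact zigzag_obj_of_zigzag _ (isPreconnected_zigzag a b)

end ComponentElements

end CategoryTheory.Functor

/-- Comprehensive factorization: every functor `F : C ⥤ D` factors as a final functor
followed by a discrete fibration. -/
theorem comprehensive_factorization_discrete_fibration
    {C : Type u₁} {D : Type u₂} [Category.{v₁} C] [Category.{v₂} D] (F : C ⥤ D) :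
    ∃ (E : Cat.{v₂, max u₁ u₂ v₂}) (p : E ⥤ D) (s : C ⥤ E),
      IsDiscreteFibration p ∧ s.Final ∧ s ⋙ p = F :=
  ⟨Cat.of (Functor.ComponentElements F), Functor.ComponentElements.proj F,
    Functor.ComponentElements.unit F, Functor.ComponentElements.isDiscreteFibration_proj,
    inferInstanceAs (Functor.ComponentElements.unit F).Final, rfl⟩
end

section
/- Every functor F : C ⥤ D between categories factors as F = s ⋙ p, where p : E ⥤ D is a discrete opfibration (for every object X of E and every morphism u : p.obj X ⟶ d in D there is a unique morphism h in E with domain X such that p.map h = u) and s : C ⥤ E is an initial functor. -/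
open CategoryTheory Opposite

universe v₁ v₂ u₁ u₂

/-- A functor `p : E ⥤ C` is a *discrete opfibration* if for every object `X` of `E` and every
morphism `u : p.obj X ⟶ c` in `C` there is a unique morphism `h : X ⟶ X'` of `E` lying over `u`
(i.e. `p.obj X' = c` and `p.map h` equals `u` modulo this identification). -/
def IsDiscreteOpfibration {E : Type*} {C : Type*} [Category E] [Category C] (p : E ⥤ C) : Prop :=
  ∀ ⦃X : E⦄ ⦃c : C⦄ (u : p.obj X ⟶ c),
    ∃! fh : (X' : E) × (X ⟶ X'), ∃ e : p.obj fh.1 = c, p.map fh.2 = u ≫ eqToHom e.symm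

namespace CategoryTheory

/-- The forgetful functor from the category of elements is a discrete opfibration. -/
theorem CategoryOfElements.isDiscreteOpfibration_π {D : Type*} [Category D] (G : D ⥤ Type*) :
    IsDiscreteOpfibration (CategoryOfElements.π G) := by
  rintro ⟨d, x⟩ d' (u : d ⟶ d')
  refine ⟨⟨⟨d', G.map u x⟩, ⟨u, rfl⟩⟩, ⟨rfl, (Category.comp_id u).symm⟩, ?_⟩
  rintro ⟨⟨d'', y⟩, f⟩ ⟨e, h⟩
  obtain rfl : d'' = d' := e
  have hf : f.val = u := h.trans (Category.comp_id u)
  obtain rfl : G.map u x = y := hf ▸ f.property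
  obtain rfl : f = ⟨u, rfl⟩ := Subtype.ext hf
  rfl

namespace Functor

variable {C : Type u₁} {D : Type u₂} [Category.{v₁} C] [Category.{v₂} D] (F : C ⥤ D)

/-- The functor sending `d` to the set of connected components of the comma category `F ↓ d`. -/
def costructuredArrowComponents : D ⥤ Type (max u₁ v₂) where
  obj d := ConnectedComponents (CostructuredArrow F d)
  map u := TypeCat.ofHom (CostructuredArrow.map u).mapConnectedComponents
  map_id d := by
    ext x
    induction x using _root_.Quotient.inductionOn with | _ x =>
    exact congrArg ConnectedComponents.mk (CostructuredArrow.map_id (f := x))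
  map_comp u v := by
    ext x
    induction x using _root_.Quotient.inductionOn with | _ x =>
    exact congrArg ConnectedComponents.mk (CostructuredArrow.map_comp (h := x))

variable {F} in
theorem costructuredArrowComponents_map_mk {d d' : D} (u : d ⟶ d') (x : CostructuredArrow F d) :
    F.costructuredArrowComponents.map u (ConnectedComponents.mk x) =
      ConnectedComponents.mk ((CostructuredArrow.map u).obj x) :=
  rfl

variable {F} in
theorem costructuredArrowComponents_map_mk_id {c : C} {d : D} (u : F.obj c ⟶ d) :
    F.costructuredArrowComponents.map u
        (ConnectedComponents.mk (CostructuredArrow.mk (𝟙 (F.obj c)))) =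
      ConnectedComponents.mk (CostructuredArrow.mk u) := by
  rw [costructuredArrowComponents_map_mk, CostructuredArrow.map_mk, Category.id_comp]

/-- The functor to the category of elements of `F.costructuredArrowComponents` sending `c` to the
component of the identity of `F.obj c`. -/
def toElementsComponents : C ⥤ F.costructuredArrowComponents.Elements where
  obj c := ⟨F.obj c, ConnectedComponents.mk (CostructuredArrow.mk (𝟙 (F.obj c)))⟩
  map {c c'} g := ⟨F.map g, (costructuredArrowComponents_map_mk_id _).trans
    (_root_.Quotient.sound (Zigzag.of_hom (CostructuredArrow.homMk g)))⟩
  map_id c := by ext; exact F.map_id c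
  map_comp f g := by ext; exact F.map_comp f g

/-- A connected component of `F ↓ d`, viewed as an element, maps to the comma category of
`F.toElementsComponents` over that element. -/
def componentToCostructuredArrow {d : D} (q : ConnectedComponents (CostructuredArrow F d)) :
    q.Component ⥤ CostructuredArrow F.toElementsComponents
      (F.costructuredArrowComponents.elementsMk d q) where
  obj x := CostructuredArrow.mk (Y := x.obj.left)
    ⟨x.obj.hom, (costructuredArrowComponents_map_mk_id _).trans x.property⟩
  map f := CostructuredArrow.homMk f.hom.left (by ext; exact CostructuredArrow.w f.hom)

theorem isConnected_costructuredArrow_toElementsComponents {d : D}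
    (q : ConnectedComponents (CostructuredArrow F d)) :
    IsConnected (CostructuredArrow F.toElementsComponents
      (F.costructuredArrowComponents.elementsMk d q)) := by
  let G := F.componentToCostructuredArrow q
  have hG (Y) : ∃ x, G.obj x = Y :=
    ⟨⟨CostructuredArrow.mk Y.hom.val,
      (costructuredArrowComponents_map_mk_id _).symm.trans Y.hom.property⟩,
      (CostructuredArrow.eq_mk Y).symm⟩
  have := (inferInstance : Nonempty q.Component).map G.obj
  refine zigzag_isConnected fun Y Z ↦ ?_
  obtain ⟨x, rfl⟩ := hG Y
  obtain ⟨y, rfl⟩ := hG Z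
  exact zigzag_obj_of_zigzag G (isPreconnected_zigzag x y)

theorem initial_toElementsComponents : F.toElementsComponents.Initial where
  out e := F.isConnected_costructuredArrow_toElementsComponents e.2

end Functor

end CategoryTheory

/-- Comprehensive factorization: every functor `F : C ⥤ D` factors as an initial functor
followed by a discrete opfibration. -/
theorem comprehensive_factorization_discrete_opfibration
    {C : Type u₁} {D : Type u₂} [Category.{v₁} C] [Category.{v₂} D] (F : C ⥤ D) :
    ∃ (E : Cat.{v₂, max u₁ u₂ v₂}) (p : E ⥤ D) (s : C ⥤ E),
      IsDiscreteOpfibration p ∧ s.Initial ∧ s ⋙ p = F := by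
  exact ⟨Cat.of F.costructuredArrowComponents.Elements, CategoryOfElements.π _,
    F.toElementsComponents, CategoryOfElements.isDiscreteOpfibration_π _,
    F.initial_toElementsComponents, rfl⟩
end

section
/- Every discrete fibration is, up to isomorphism over the base, a category of elements: if p : E ⥤ C is a discrete fibration, then there exist a functor W : Cᵒᵖ ⥤ Type and an isomorphism of categories (a functor H : E ⥤ ∫W that has a strict inverse) such that H composed with the forgetful projection ∫W ⥤ C equals p. -/
open CategoryTheory Opposite

universe w v u v' u'

variable {C : Type u} [Category.{v} C]

/-- The category of elements of a presheaf `W : Cᵒᵖ ⥤ Type w`: objects are pairs `(c, x)` with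
`x ∈ W(c)`, and morphisms `(c', x') ⟶ (c, x)` are morphisms `f : c' ⟶ c` with `W(f)(x) = x'`. -/
structure ElementsCat (W : Cᵒᵖ ⥤ Type w) : Type max u w where
  pt : C
  elt : W.obj (op pt)

instance instElementsCatCategory (W : Cᵒᵖ ⥤ Type w) : Category.{v} (ElementsCat W) where
  Hom a b := { f : a.pt ⟶ b.pt // W.map f.op b.elt = a.elt }
  id a := ⟨𝟙 a.pt, by simp⟩
  comp {a b c} f g := ⟨f.1 ≫ g.1, by
    rw [op_comp, W.map_comp, types_comp_apply, g.2, f.2]⟩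
  id_comp f := Subtype.ext (Category.id_comp f.1)
  comp_id f := Subtype.ext (Category.comp_id f.1)
  assoc f g h := Subtype.ext (Category.assoc f.1 g.1 h.1)

/-- The forgetful projection from the category of elements of `W` to `C`. -/
def elementsProj (W : Cᵒᵖ ⥤ Type w) : ElementsCat W ⥤ C where
  obj a := a.pt
  map f := f.1

namespace IsDiscreteFibration

section

variable {E : Type u'} [Category.{v'} E] {p : E ⥤ C}

/-- Two morphisms over the same morphism have the same domain. -/
lemma dom_eq (hp : IsDiscreteFibration p) {X Y Y' : E} {c : C} (u : c ⟶ p.obj X)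
    (f : Y ⟶ X) (f' : Y' ⟶ X) (e : p.obj Y = c) (e' : p.obj Y' = c)
    (h : p.map f = eqToHom e ≫ u) (h' : p.map f' = eqToHom e' ≫ u) : Y = Y' :=
  congrArg Sigma.fst ((hp u).unique (y₁ := ⟨Y, f⟩) (y₂ := ⟨Y', f'⟩) ⟨e, h⟩ ⟨e', h'⟩)

lemma faithful (hp : IsDiscreteFibration p) : p.Faithful where
  map_injective {Y X f f'} h := by
    have := (hp (p.map f)).unique (y₁ := ⟨Y, f⟩) (y₂ := ⟨Y, f'⟩) ⟨rfl, by simp⟩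
      ⟨rfl, by simp [h]⟩
    simpa using this

/-- The domain of the unique lift of a morphism with codomain `p.obj X`. -/
noncomputable def liftDom (hp : IsDiscreteFibration p) {X : E} {c : C} (u : c ⟶ p.obj X) : E :=
  (hp u).choose.1

/-- The unique lift of a morphism with codomain `p.obj X`. -/
noncomputable def lift (hp : IsDiscreteFibration p) {X : E} {c : C} (u : c ⟶ p.obj X) :
    hp.liftDom u ⟶ X :=
  (hp u).choose.2

lemma obj_liftDom (hp : IsDiscreteFibration p) {X : E} {c : C} (u : c ⟶ p.obj X) :
    p.obj (hp.liftDom u) = c :=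
  (hp u).choose_spec.1.choose

lemma map_lift (hp : IsDiscreteFibration p) {X : E} {c : C} (u : c ⟶ p.obj X) :
    p.map (hp.lift u) = eqToHom (hp.obj_liftDom u) ≫ u :=
  (hp u).choose_spec.1.choose_spec

lemma liftDom_eq (hp : IsDiscreteFibration p) {X Y : E} {c : C} (u : c ⟶ p.obj X)
    (f : Y ⟶ X) (e : p.obj Y = c) (h : p.map f = eqToHom e ≫ u) : hp.liftDom u = Y :=
  hp.dom_eq u _ f _ e (hp.map_lift u) h

/-- The presheaf of fibres of a discrete fibration. -/
noncomputable def fibers (hp : IsDiscreteFibration p) : Cᵒᵖ ⥤ Type u' where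
  obj c := { X : E // p.obj X = c.unop }
  map u := ↾fun X => ⟨hp.liftDom (u.unop ≫ eqToHom X.2.symm), hp.obj_liftDom _⟩
  map_id c := by
    ext X
    exact hp.liftDom_eq ((𝟙 c : c ⟶ c).unop ≫ eqToHom X.2.symm) (𝟙 X.1) X.2 (by simp)
  map_comp u v := by
    ext X
    exact hp.liftDom_eq ((u ≫ v).unop ≫ eqToHom X.2.symm)
      (hp.lift (v.unop ≫ eqToHom (hp.obj_liftDom _).symm) ≫ hp.lift (u.unop ≫ eqToHom X.2.symm))
      (hp.obj_liftDom _) (by simp [map_lift])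

lemma fibers_map_eq (hp : IsDiscreteFibration p) {c d : C} (u : c ⟶ d)
    (X : hp.fibers.obj (op d)) (Y : hp.fibers.obj (op c)) (f : Y.1 ⟶ X.1)
    (h : p.map f = eqToHom Y.2 ≫ u ≫ eqToHom X.2.symm) : hp.fibers.map u.op X = Y :=
  Subtype.ext (hp.liftDom_eq _ f Y.2 h)

lemma exists_map_eq (hp : IsDiscreteFibration p) {a b : ElementsCat hp.fibers} (f : a ⟶ b) :
    ∃ g : a.elt.1 ⟶ b.elt.1,
      p.map g = eqToHom a.elt.2 ≫ f.1 ≫ eqToHom b.elt.2.symm := by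
  have e : hp.liftDom (f.1 ≫ eqToHom b.elt.2.symm) = a.elt.1 := congrArg Subtype.val f.2
  exact ⟨eqToHom e.symm ≫ hp.lift _, by simp [map_lift, eqToHom_map]⟩

/-- The comparison functor from the total category to the category of elements of the fibres. -/
noncomputable def toElements (hp : IsDiscreteFibration p) : E ⥤ ElementsCat hp.fibers where
  obj X := ⟨p.obj X, ⟨X, rfl⟩⟩
  map f := ⟨p.map f, hp.fibers_map_eq _ _ _ f (by simp)⟩
  map_id X := Subtype.ext (p.map_id X)
  map_comp f g := Subtype.ext (p.map_comp f g)

/-- The inverse of `IsDiscreteFibration.toElements`. -/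
noncomputable def ofElements (hp : IsDiscreteFibration p) : ElementsCat hp.fibers ⥤ E where
  obj a := a.elt.1
  map f := (hp.exists_map_eq f).choose
  map_id a := hp.faithful.map_injective <| by
    rw [(hp.exists_map_eq (𝟙 a)).choose_spec]
    simp [CategoryStruct.id]
  map_comp f g := hp.faithful.map_injective <| by
    rw [(hp.exists_map_eq (f ≫ g)).choose_spec, p.map_comp, (hp.exists_map_eq f).choose_spec,
      (hp.exists_map_eq g).choose_spec]
    change _ ≫ (f.1 ≫ g.1) ≫ _ = _
    simp

lemma map_ofElements_map (hp : IsDiscreteFibration p) {a b : ElementsCat hp.fibers} (f : a ⟶ b) :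
    p.map (hp.ofElements.map f) = eqToHom a.elt.2 ≫ f.1 ≫ eqToHom b.elt.2.symm :=
  (hp.exists_map_eq f).choose_spec

lemma toElements_comp_ofElements (hp : IsDiscreteFibration p) :
    hp.toElements ⋙ hp.ofElements = 𝟭 E :=
  CategoryTheory.Functor.ext (fun _ => rfl) fun X Y f => hp.faithful.map_injective <| by
    refine (hp.map_ofElements_map (hp.toElements.map f)).trans ?_
    change 𝟙 _ ≫ p.map f ≫ 𝟙 _ = p.map (𝟙 _ ≫ f ≫ 𝟙 _)
    simp

lemma ofElements_comp_toElements (hp : IsDiscreteFibration p) :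
    hp.ofElements ⋙ hp.toElements = 𝟭 (ElementsCat hp.fibers) := by
  refine CategoryTheory.Functor.ext ?_ ?_
  · rintro ⟨c, X, hX⟩
    obtain rfl : p.obj X = c := hX
    rfl
  · rintro ⟨c, X, hX⟩ ⟨d, Y, hY⟩ f
    obtain rfl : p.obj X = c := hX
    obtain rfl : p.obj Y = d := hY
    exact Subtype.ext (hp.map_ofElements_map f)

end

end IsDiscreteFibration

/-- Every discrete fibration is, up to isomorphism of categories over the base, the forgetful
projection from a category of elements: there is a presheaf `W` and a functor
`H : E ⥤ ElementsCat W` admitting a strict inverse, with `H ⋙ elementsProj W = p`. -/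
theorem discreteFibration_iso_elements {E : Type u'} [Category.{v'} E]
    (p : E ⥤ C) (hp : IsDiscreteFibration p) :
    ∃ (W : Cᵒᵖ ⥤ Type u') (H : E ⥤ ElementsCat W) (H' : ElementsCat W ⥤ E),
      H ⋙ H' = 𝟭 E ∧ H' ⋙ H = 𝟭 (ElementsCat W) ∧ H ⋙ elementsProj W = p := by
  exact ⟨hp.fibers, hp.toElements, hp.ofElements, hp.toElements_comp_ofElements,
    hp.ofElements_comp_toElements, rfl⟩
end

section
/- Let G be a nonempty maximally connected groupoid (a category with exactly one morphism between any two objects), let p : E ⥤ G be a discrete fibration, and let X be the fibre of p over some fixed object of G. Then p is isomorphic over G to the second projection from the product category (Discrete X) × G to G: there exists an isomorphism of categories H : E ⥤ (Discrete X) × G (a functor with a strict inverse) such that H followed by the projection to G equals p. -/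
open CategoryTheory

/-- The fibre of a functor `p : E ⥤ C` over an object `c : C`. -/
def Fiber {E C : Type*} [Category E] [Category C] (p : E ⥤ C) (c : C) :=
  { X : E // p.obj X = c }

namespace IsDiscreteFibration

variable {E G : Type*} [Category E] [Category G] {p : E ⥤ G}

/-- Two arrows with the same target, whose images have the same source in a thin base,
are equal, sources included. -/
theorem sigma_eq_of_obj_eq [Quiver.IsThin G] (hp : IsDiscreteFibration p) {Y Z Z' : E}
    (f : Z ⟶ Y) (f' : Z' ⟶ Y) (h : p.obj Z = p.obj Z') :
    (⟨Z, f⟩ : (W : E) × (W ⟶ Y)) = ⟨Z', f'⟩ :=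
  (hp (p.map f')).unique ⟨h, Subsingleton.elim _ _⟩ ⟨rfl, Subsingleton.elim _ _⟩

theorem source_eq [Quiver.IsThin G] (hp : IsDiscreteFibration p) {Y Z Z' : E}
    (f : Z ⟶ Y) (f' : Z' ⟶ Y) (h : p.obj Z = p.obj Z') : Z = Z' :=
  congrArg Sigma.fst (hp.sigma_eq_of_obj_eq f f' h)

theorem isThin [Quiver.IsThin G] (hp : IsDiscreteFibration p) : Quiver.IsThin E :=
  fun _ _ => ⟨fun f f' => eq_of_heq (Sigma.mk.inj (hp.sigma_eq_of_obj_eq f f' rfl)).2⟩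

theorem exists_lift (hp : IsDiscreteFibration p) {Y : E} {c : G} (u : c ⟶ p.obj Y) :
    ∃ Z : E, p.obj Z = c ∧ Nonempty (Z ⟶ Y) := by
  obtain ⟨⟨Z, f⟩, ⟨e, -⟩, -⟩ := hp u
  exact ⟨Z, e, ⟨f⟩⟩

end IsDiscreteFibration

theorem CategoryTheory.Functor.eq_of_obj_eq_of_isThin {C D : Type*} [Category C] [Category D]
    [Quiver.IsThin D] {F F' : C ⥤ D} (h : ∀ X, F.obj X = F'.obj X) : F = F' :=
  Functor.ext h fun _ _ _ => Subsingleton.elim _ _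

/-- Let `G` be a nonempty maximally connected groupoid (a category with exactly one morphism
between any two given objects), `p : E ⥤ G` a discrete fibration, and `X = Fiber p g₀` the
fibre over a fixed object `g₀`.  Then `p` is isomorphic over `G` to the second projection
`(Discrete X) × G ⥤ G`: there is a functor `H : E ⥤ (Discrete X) × G` with a strict inverse
such that `H` followed by the second projection equals `p`. -/
theorem mcg_discreteFibration_trivial
    {G E : Type*} [Category G] [Category E] [Nonempty G]
    (mcg_exists : ∀ A B : G, Nonempty (A ⟶ B))
    (mcg_unique : ∀ (A B : G) (f g : A ⟶ B), f = g)
    (p : E ⥤ G) (hp : IsDiscreteFibration p) (g₀ : G) :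
    ∃ (H : E ⥤ Discrete (Fiber p g₀) × G) (H' : Discrete (Fiber p g₀) × G ⥤ E),
      H ⋙ H' = 𝟭 E ∧ H' ⋙ H = 𝟭 (Discrete (Fiber p g₀) × G) ∧
      H ⋙ CategoryTheory.Prod.snd (Discrete (Fiber p g₀)) G = p := by
  have : Quiver.IsThin G := fun A B => ⟨mcg_unique A B⟩
  have : Quiver.IsThin E := hp.isThin
  have : Quiver.IsThin (Discrete (Fiber p g₀) × G) := fun A B =>
    ⟨fun _ _ => Prod.ext (Subsingleton.elim _ _) (Subsingleton.elim _ _)⟩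
  choose lift obj_lift hom using
    fun (c : G) (Y : E) => hp.exists_lift (mcg_exists c (p.obj Y)).some
  have lift_eq {c : G} {Y Z : E} (f : Z ⟶ Y) (h : p.obj Z = c) : lift c Y = Z :=
    hp.source_eq (hom c Y).some f ((obj_lift c Y).trans h.symm)
  have lift_lift (c d : G) (Y : E) : lift c (lift d Y) = lift c Y :=
    (lift_eq ((hom c (lift d Y)).some ≫ (hom d Y).some) (obj_lift c _)).symm
  have lift_eq_of_hom (c : G) {Y Z : E} (f : Y ⟶ Z) : lift c Y = lift c Z :=
    (lift_eq ((hom c Y).some ≫ f) (obj_lift c Y)).symm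
  let H : E ⥤ Discrete (Fiber p g₀) × G :=
    { obj := fun Y => (⟨⟨lift g₀ Y, obj_lift g₀ Y⟩⟩, p.obj Y)
      map := fun f => (Discrete.eqToHom (Subtype.ext (lift_eq_of_hom g₀ f)), p.map f)
      map_id := fun _ => Subsingleton.elim _ _
      map_comp := fun _ _ => Subsingleton.elim _ _ }
  let H' : Discrete (Fiber p g₀) × G ⥤ E :=
    { obj := fun A => lift A.2 A.1.as.1
      map := fun {A B} f =>
        eqToHom ((congrArg (fun x => lift A.2 x.1) (Discrete.eq_of_hom f.1)).trans
          (lift_lift A.2 B.2 B.1.as.1).symm) ≫ (hom A.2 (lift B.2 B.1.as.1)).some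
      map_id := fun _ => Subsingleton.elim _ _
      map_comp := fun _ _ => Subsingleton.elim _ _ }
  refine ⟨H, H', Functor.eq_of_obj_eq_of_isThin fun Y => ?_,
    Functor.eq_of_obj_eq_of_isThin fun A => ?_, rfl⟩
  · exact (lift_lift (p.obj Y) g₀ Y).trans (lift_eq (𝟙 Y) rfl)
  · exact Prod.ext
      (Discrete.ext (Subtype.ext
        ((lift_lift g₀ A.2 A.1.as.1).trans (lift_eq (𝟙 A.1.as.1) A.1.as.2))))
      (obj_lift A.2 A.1.as.1)
end
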